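/- Let E be a finite-dimensional real inner product space, let C ⊆ E be nonempty, closed and convex with Euclidean projection proj_C, and let f : E × E → ℝ and g : E × E → E be such that for every fixed y ∈ E: (i) x ↦ f(x, y) is differentiable with gradient g(·, y) and is α-strongly convex (α > 0); (ii) g(·, y) is β-Lipschitz with 0 < α ≤ β; and (iii) for every fixed x ∈ E, y ↦ g(x, y) is (β ε)-Lipschitz (ε ≥ 0). Let η > 0, and suppose x̄ ∈ E satisfies x̄ = proj_C(x̄ − η g(x̄, x̄)). Then for every x ∈ E, the online projected gradient update x⁺ = proj_C(x − η g(x, x)) satisfies ‖x⁺ − x̄‖ ≤ (ρ + η β ε) ‖x − x̄‖, where ρ = max{|1 − η α|, |1 − η β|}. -/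

import Mathlib

open scoped RealInnerProductSpace

section Helpers

variable {E : Type*} [NormedAddCommGroup E] [InnerProductSpace ℝ E]

theorem norm_sub_le_of_forall_norm_sub_le {C : Set E} (hC : Convex ℝ C) {proj : E → E}
    (hproj : ∀ x, proj x ∈ C ∧ ∀ u ∈ C, ‖x - proj x‖ ≤ ‖x - u‖) (x y : E) :
    ‖proj x - proj y‖ ≤ ‖x - y‖ := by
  have key : ∀ x, ∀ w ∈ C, ⟪x - proj x, w - proj x⟫ ≤ 0 := fun x => by
    refine (norm_eq_iInf_iff_real_inner_le_zero hC (hproj x).1).1 (le_antisymm ?_ ?_)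
    · have : Nonempty C := ⟨⟨_, (hproj x).1⟩⟩
      exact le_ciInf fun w => (hproj x).2 w w.2
    · exact ciInf_le (f := fun w : C => ‖x - w‖)
        ⟨0, by rintro _ ⟨w, rfl⟩; exact norm_nonneg _⟩ ⟨_, (hproj x).1⟩
  have hx := key x _ (hproj y).1
  have hy := key y _ (hproj x).1
  have hsum : ⟪x - proj x, proj y - proj x⟫ + ⟪y - proj y, proj x - proj y⟫
      = ‖proj x - proj y‖ ^ 2 - ⟪x - y, proj x - proj y⟫ := by
    rw [← real_inner_self_eq_norm_sq]
    simp only [inner_sub_left, inner_sub_right]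
    ring
  have hcs := real_inner_le_norm (x - y) (proj x - proj y)
  by_contra! h
  nlinarith [norm_nonneg (x - y), norm_nonneg (proj x - proj y)]

/-- A function squeezed between quadratics of curvature `±r` around each of its points has
`r`-Lipschitz slopes. -/
theorem norm_sub_le_of_abs_sub_inner_le {h : E → ℝ} {G : E → E} {r : ℝ}
    (hh : ∀ x z, |h z - h x - ⟪G x, z - x⟫| ≤ r / 2 * ‖z - x‖ ^ 2) (x y : E) :
    ‖G x - G y‖ ≤ r * ‖x - y‖ := by
  obtain ⟨p, hp⟩ : ∃ p : E, p = (2⁻¹ : ℝ) • (x - y) := ⟨_, rfl⟩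
  have hxy : x = y + (2 : ℝ) • p := by rw [hp, smul_smul]; simp
  have hv : ∀ v : E, ⟪G x - G y, v⟫ ≤ r * (‖v‖ ^ 2 + ‖p‖ ^ 2) := fun v => by
    have h₁ := (abs_le.1 (hh x (y + p - v))).2
    have h₂ := (abs_le.1 (hh y (y + p - v))).1
    have h₃ := (abs_le.1 (hh x (y + p + v))).1
    have h₄ := (abs_le.1 (hh y (y + p + v))).2
    have e₁ : y + p - v - x = -(p + v) := by rw [hxy]; module
    have e₂ : y + p - v - y = p - v := by module
    have e₃ : y + p + v - x = -(p - v) := by rw [hxy]; module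
    have e₄ : y + p + v - y = p + v := by module
    rw [e₁, norm_neg] at h₁
    rw [e₂] at h₂
    rw [e₃, norm_neg] at h₃
    rw [e₄] at h₄
    simp only [inner_neg_right, inner_add_right, inner_sub_right] at h₁ h₂ h₃ h₄
    rw [inner_sub_left]
    have hpar : r * (‖p + v‖ ^ 2 + ‖p - v‖ ^ 2) = r * (2 * (‖p‖ ^ 2 + ‖v‖ ^ 2)) := by
      rw [parallelogram_law_with_norm ℝ p v]
    linarith
  rcases eq_or_ne (G x - G y) 0 with hD | hD
  · rw [hD, norm_zero]
    have := (abs_nonneg _).trans (hh y x)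
    by_contra! hneg
    rcases (norm_nonneg (x - y)).eq_or_lt with h0 | h0
    · simp [← h0] at hneg
    · nlinarith
  have hDpos := norm_pos_iff.2 hD
  have hpn : ‖x - y‖ = 2 * ‖p‖ := by rw [hp, norm_smul]; norm_num; ring
  have hs := hv ((‖p‖ / ‖G x - G y‖) • (G x - G y))
  rw [inner_smul_right, real_inner_self_eq_norm_sq, norm_smul, Real.norm_of_nonneg (by positivity),
    div_mul_cancel₀ _ hDpos.ne'] at hs
  have hs' : ‖p‖ * ‖G x - G y‖ ≤ ‖p‖ * (r * (2 * ‖p‖)) := by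
    calc _ = ‖p‖ / ‖G x - G y‖ * ‖G x - G y‖ ^ 2 := by field_simp
      _ ≤ _ := hs
      _ = _ := by ring
  rw [hpn]
  rcases (norm_nonneg p).eq_or_lt with h0 | h0
  · have hp0 : p = 0 := norm_eq_zero.1 h0.symm
    rw [hp0] at hxy
    simp [hxy] at hD
  · exact le_of_mul_le_mul_left hs' h0

theorem HasGradientAt.hasDerivAt_comp_line [CompleteSpace E] {F : E → ℝ} {G x d : E} {t : ℝ}
    (hF : HasGradientAt F G (x + t • d)) :
    HasDerivAt (fun s : ℝ => F (x + s • d)) ⟪G, d⟫ t := by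
  have hl : HasDerivAt (fun s : ℝ => x + s • d) d t := by
    simpa using ((hasDerivAt_id t).smul_const d).const_add x
  exact (hF.hasFDerivAt.comp_hasDerivAt t hl).congr_deriv (by simp)

/-- The descent lemma. -/
theorem le_add_inner_add_of_lipschitz_gradient [CompleteSpace E] {F : E → ℝ} {G : E → E} {β : ℝ}
    (hF : ∀ x, HasGradientAt F (G x) x) (hG : ∀ x y, ‖G x - G y‖ ≤ β * ‖x - y‖) (x z : E) :
    F z ≤ F x + ⟪G x, z - x⟫ + β / 2 * ‖z - x‖ ^ 2 := by
  set d := z - x with hd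
  have hder : ∀ t : ℝ, HasDerivAt
      (fun s : ℝ => F (x + s • d) - s * ⟪G x, d⟫ - β / 2 * ‖d‖ ^ 2 * s ^ 2)
      (⟪G (x + t • d), d⟫ - ⟪G x, d⟫ - β * ‖d‖ ^ 2 * t) t := fun t => by
    have h₁ := (hF (x + t • d)).hasDerivAt_comp_line
    have h₂ := (hasDerivAt_id t).mul_const ⟪G x, d⟫
    have h₃ := (hasDerivAt_pow 2 t).const_mul (β / 2 * ‖d‖ ^ 2)
    refine ((h₁.sub h₂).sub h₃).congr_deriv ?_
    push_cast
    ring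
  have hanti := antitoneOn_of_deriv_nonpos (convex_Icc (0 : ℝ) 1)
    (fun t _ => (hder t).continuousAt.continuousWithinAt)
    (fun t _ => (hder t).differentiableAt.differentiableWithinAt) (fun t ht => by
      rw [interior_Icc] at ht
      rw [(hder t).deriv, ← inner_sub_left]
      have h₁ := real_inner_le_norm (G (x + t • d) - G x) d
      have h₂ := hG (x + t • d) x
      rw [add_sub_cancel_left, norm_smul, Real.norm_of_nonneg ht.1.le] at h₂
      nlinarith [norm_nonneg d])
  have h01 := hanti (Set.left_mem_Icc.2 zero_le_one) (Set.right_mem_Icc.2 zero_le_one) zero_le_one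
  have hz : x + d = z := by rw [hd]; abel
  simp only [one_smul, zero_smul, add_zero, hz] at h01
  linarith

theorem add_inner_add_le_of_strongly_convex [CompleteSpace E] {F : E → ℝ} {G : E → E} {α : ℝ}
    (hF : ∀ x, HasGradientAt F (G x) x)
    (hc : ConvexOn ℝ Set.univ (fun x => F x - α / 2 * ‖x‖ ^ 2)) (x z : E) :
    F x + ⟪G x, z - x⟫ + α / 2 * ‖z - x‖ ^ 2 ≤ F z := by
  set d := z - x with hd
  have hz : x + d = z := by rw [hd]; abel
  have hnorm : ∀ s : ℝ, ‖x + s • d‖ ^ 2 = ‖x‖ ^ 2 + 2 * ⟪x, d⟫ * s + ‖d‖ ^ 2 * s ^ 2 := fun s => by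
    rw [norm_add_sq_real, inner_smul_right, norm_smul, mul_pow, Real.norm_eq_abs, sq_abs]
    ring
  have hconv : ConvexOn ℝ Set.univ
      (fun s : ℝ => F (x + s • d) - α / 2 * ‖x + s • d‖ ^ 2) := by
    have := hc.comp_affineMap (AffineMap.lineMap x z : ℝ →ᵃ[ℝ] E)
    simpa [Function.comp_def, AffineMap.lineMap_apply, ← hd, add_comm] using this
  have hder : HasDerivAt (fun s : ℝ => F (x + s • d) - α / 2 * ‖x + s • d‖ ^ 2)
      (⟪G x, d⟫ - α * ⟪x, d⟫) 0 := by
    simp only [hnorm]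
    have h₁ := HasGradientAt.hasDerivAt_comp_line (d := d) (t := 0) (x := x) (by simpa using hF x)
    have h₂ := (hasDerivAt_id (0 : ℝ)).const_mul (2 * ⟪x, d⟫)
    have h₃ := (hasDerivAt_pow 2 (0 : ℝ)).const_mul (‖d‖ ^ 2)
    refine (h₁.sub (((h₂.const_add (‖x‖ ^ 2)).add h₃).const_mul (α / 2))).congr_deriv ?_
    push_cast
    ring
  have hs := hconv.le_slope_of_hasDerivAt (Set.mem_univ 0) (Set.mem_univ 1) zero_lt_one hder
  rw [slope_def_field] at hs
  have hn := hnorm 1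
  rw [one_smul, hz] at hn
  simp only [one_smul, zero_smul, add_zero, hz, hn, sub_zero, div_one] at hs
  linarith

/-- The gradient step on a strongly convex function with Lipschitz gradient is Lipschitz. -/
theorem norm_gradient_step_sub_le [CompleteSpace E] {F : E → ℝ} {G : E → E} {α β η : ℝ}
    (hη : 0 ≤ η) (hF : ∀ x, HasGradientAt F (G x) x)
    (hc : ConvexOn ℝ Set.univ (fun x => F x - α / 2 * ‖x‖ ^ 2))
    (hG : ∀ x y, ‖G x - G y‖ ≤ β * ‖x - y‖) (x y : E) :
    ‖(x - y) - η • (G x - G y)‖ ≤ max |1 - η * α| |1 - η * β| * ‖x - y‖ := by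
  set c := (α + β) / 2 with hcdef
  have hquad : ∀ x z : E, |(F z - c / 2 * ‖z‖ ^ 2) - (F x - c / 2 * ‖x‖ ^ 2)
      - ⟪G x - c • x, z - x⟫| ≤ (β - α) / 2 / 2 * ‖z - x‖ ^ 2 := fun x z => by
    have hu := le_add_inner_add_of_lipschitz_gradient hF hG x z
    have hl := add_inner_add_le_of_strongly_convex hF hc x z
    have hn : ‖z‖ ^ 2 = ‖x‖ ^ 2 + 2 * ⟪x, z - x⟫ + ‖z - x‖ ^ 2 := by
      rw [← norm_add_sq_real, add_sub_cancel]
    rw [inner_sub_left, real_inner_smul_left, hn, abs_le]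
    constructor <;> rw [hcdef] <;> linarith
  have hm := norm_sub_le_of_abs_sub_inner_le (h := fun x => F x - c / 2 * ‖x‖ ^ 2)
    (G := fun x => G x - c • x) hquad x y
  have hρ : |1 - η * c| + η * ((β - α) / 2) ≤ max |1 - η * α| |1 - η * β| := by
    rcases abs_cases (1 - η * c) with ⟨h, _⟩ | ⟨h, _⟩ <;> rw [h, hcdef]
    · exact le_max_of_le_left (le_trans (by linarith) (le_abs_self _))
    · exact le_max_of_le_right (le_trans (by linarith) (neg_le_abs _))
  calc ‖(x - y) - η • (G x - G y)‖
      = ‖(1 - η * c) • (x - y) - η • ((G x - c • x) - (G y - c • y))‖ := by congr 1; module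
    _ ≤ |1 - η * c| * ‖x - y‖ + η * ‖(G x - c • x) - (G y - c • y)‖ := by
      refine (norm_sub_le _ _).trans_eq ?_
      rw [norm_smul, norm_smul, Real.norm_eq_abs, Real.norm_of_nonneg hη]
    _ ≤ |1 - η * c| * ‖x - y‖ + η * ((β - α) / 2 * ‖x - y‖) := by gcongr
    _ = (|1 - η * c| + η * ((β - α) / 2)) * ‖x - y‖ := by ring
    _ ≤ _ := by gcongr

end Helpers


/-- One-step contraction of the online projected gradient update toward the
performatively stable point: `‖x⁺ − x̄‖ ≤ (ρ + ηβε)‖x − x̄‖` with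
`ρ = max{|1 − ηα|, |1 − ηβ|}`. -/
theorem opgd_one_step_contraction
    {E : Type*} [NormedAddCommGroup E] [InnerProductSpace ℝ E]
    [FiniteDimensional ℝ E]
    (C : Set E) (hCne : C.Nonempty) (hCclosed : IsClosed C) (hCconv : Convex ℝ C)
    (proj : E → E)
    (hproj : ∀ x, proj x ∈ C ∧ ∀ u ∈ C, ‖x - proj x‖ ≤ ‖x - u‖)
    (f : E → E → ℝ) (g : E → E → E) (α β ε η : ℝ)
    (hα : 0 < α) (hαβ : α ≤ β) (hε : 0 ≤ ε) (hη : 0 < η)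
    (hgrad : ∀ y x, HasGradientAt (fun x' => f x' y) (g x y) x)
    (hsc : ∀ y, ConvexOn ℝ Set.univ (fun x => f x y - α / 2 * ‖x‖ ^ 2))
    (hglip : ∀ y x x', ‖g x y - g x' y‖ ≤ β * ‖x - x'‖)
    (hsens : ∀ x y y', ‖g x y - g x y'‖ ≤ β * ε * ‖y - y'‖)
    (xb : E) (hxb : xb = proj (xb - η • g xb xb)) :
    ∀ x : E, ‖proj (x - η • g x x) - xb‖ ≤
      (max |1 - η * α| |1 - η * β| + η * β * ε) * ‖x - xb‖ := by
  intro x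
  have : CompleteSpace E := FiniteDimensional.complete ℝ E
  have hstep := norm_gradient_step_sub_le hη.le (hgrad x) (hsc x) (hglip x) x xb
  calc ‖proj (x - η • g x x) - xb‖
      = ‖proj (x - η • g x x) - proj (xb - η • g xb xb)‖ := by rw [← hxb]
    _ ≤ ‖(x - η • g x x) - (xb - η • g xb xb)‖ :=
      norm_sub_le_of_forall_norm_sub_le hCconv hproj _ _
    _ = ‖((x - xb) - η • (g x x - g xb x)) - η • (g xb x - g xb xb)‖ := by congr 1; module
    _ ≤ ‖(x - xb) - η • (g x x - g xb x)‖ + η * ‖g xb x - g xb xb‖ := by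
      refine (norm_sub_le _ _).trans_eq ?_
      rw [norm_smul η, Real.norm_of_nonneg hη.le]
    _ ≤ max |1 - η * α| |1 - η * β| * ‖x - xb‖ + η * (β * ε * ‖x - xb‖) := by
      gcongr
      exact hsens xb x xb
    _ = _ := by ring
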